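/- Suppose φ is an H^g-formula ∀x⃗. A₁∧…∧Aₙ → A₀ with a CUP proof π of Σ; P ⊢co φ, with eigenvariables c⃗ introduced for x⃗. Let D be the set of atoms proven in π, let θ₁,…,θ_m be the agents of π, fix any ground substitution θ₀ : C → coTerms_Σ, write A_k^C = A_k[c⃗/x⃗], and define Θ on lists w over {1,…,m} by Θ(ε) = θ₀ and Θ(w:k) = Θ(w) ∘ θ_k (Kleisli composition of coterm substitutions). If I₁ is an invariant for { ⟦A_k^C⟧[Θ(ε)] : 1 ≤ k ≤ n }, then I = I₁ ∪ ⋃_{w} ⟦D⟧[Θ(w)] is an invariant for ⟦A₀^C⟧[Θ(ε)]. -/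

import Mathlib

/-! ## Simple types with a single base type `ι` -/

/-- Simple types over the single base type `ι`. -/
inductive Ty : Type
  | base : Ty
  | arrow : Ty → Ty → Ty

/-- The order of a type: `ord ι = 0`, `ord (σ→τ) = max (ord σ + 1) (ord τ)`. -/
def Ty.order : Ty → ℕ
  | .base => 0
  | .arrow σ τ => max (σ.order + 1) τ.order

/-- The arity of a (first-order) type: `ar ι = 0`, `ar (ι→τ) = ar τ + 1`. -/
def Ty.arity : Ty → ℕ
  | .base => 0
  | .arrow _ τ => τ.arity + 1

/-- A term signature assigns types to (some) constant names. -/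
abbrev Sig : Type := String → Option Ty

/-- A signature is first-order if every symbol has a type of order ≤ 1. -/
def Sig.FirstOrder (Sg : Sig) : Prop := ∀ c τ, Sg c = some τ → τ.order ≤ 1

/-- The arity of a symbol of a (first-order) signature. -/
def Sig.ar (Sg : Sig) (c : String) : ℕ := ((Sg c).map Ty.arity).getD 0

/-! ## Terms (de Bruijn representation) -/

/-- Terms of the simply typed λ-calculus with constants and a fixed point
operator `fix`, in de Bruijn representation. -/
inductive Tm : Type
  | var : ℕ → Tm
  | const : String → Tm
  | app : Tm → Tm → Tm
  | lam : Ty → Tm → Tm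
  | fix : Ty → Tm → Tm

/-- Shift ("weakening") of de Bruijn indices `≥ c` by `d`. -/
def Tm.shift (d : ℕ) : ℕ → Tm → Tm
  | c, .var n => if n < c then .var n else .var (n + d)
  | _, .const f => .const f
  | c, .app M N => .app (Tm.shift d c M) (Tm.shift d c N)
  | c, .lam τ M => .lam τ (Tm.shift d (c + 1) M)
  | c, .fix τ M => .fix τ (Tm.shift d (c + 1) M)

/-- Capture-avoiding substitution `Tm.subst k N M = M[N/k]` of the
de Bruijn variable `k` by `N` in `M`. -/
def Tm.subst : ℕ → Tm → Tm → Tm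
  | k, N, .var n => if n = k then Tm.shift k 0 N else if k < n then .var (n - 1) else .var n
  | _, _, .const f => .const f
  | k, N, .app M₁ M₂ => .app (Tm.subst k N M₁) (Tm.subst k N M₂)
  | k, N, .lam τ M => .lam τ (Tm.subst (k + 1) N M)
  | k, N, .fix τ M => .fix τ (Tm.subst (k + 1) N M)

/-- Typing contexts: lists of types (the head is de Bruijn index 0). -/
abbrev Ctx : Type := List Ty

/-- Typing judgement `Γ ⊢ M : τ` over the signature `Sg`. -/
inductive HasTy (Sg : Sig) : Ctx → Tm → Ty → Prop
  | var {Γ n τ} : Γ[n]? = some τ → HasTy Sg Γ (.var n) τ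
  | const {Γ c τ} : Sg c = some τ → HasTy Sg Γ (.const c) τ
  | app {Γ M N σ τ} : HasTy Sg Γ M (.arrow σ τ) → HasTy Sg Γ N σ → HasTy Sg Γ (.app M N) τ
  | lam {Γ M σ τ} : HasTy Sg (σ :: Γ) M τ → HasTy Sg Γ (.lam σ M) (.arrow σ τ)
  | fixI {Γ M τ} : HasTy Sg (τ :: Γ) M τ → HasTy Sg Γ (.fix τ M) τ

/-- `lams n M` is the `n`-fold λ-abstraction `λ y₁ … yₙ. M` (all of base type). -/
def lams : ℕ → Tm → Tm
  | 0, M => M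
  | n + 1, M => .lam .base (lams n M)

/-- `apps M [N₁, …, Nₙ]` is the iterated application `M N₁ … Nₙ`. -/
def apps : Tm → List Tm → Tm
  | M, [] => M
  | M, N :: Ns => apps (.app M N) Ns

/-- Guarded base terms `Γ ⊢g M : τ`. -/
inductive GBase (Sg : Sig) : Ctx → Tm → Ty → Prop
  | var {Γ n τ} : Γ[n]? = some τ → τ.order ≤ 1 → GBase Sg Γ (.var n) τ
  | const {Γ c τ} : Sg c = some τ → GBase Sg Γ (.const c) τ
  | app {Γ M N σ τ} : GBase Sg Γ M (.arrow σ τ) → GBase Sg Γ N σ → GBase Sg Γ (.app M N) τ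
  | fixI {Γ f σf τ Ms} : Sg f = some σf → τ.order ≤ 1 →
      Ms.length = σf.arity →
      (∀ M ∈ Ms, GBase Sg (List.replicate τ.arity Ty.base ++ τ :: Γ) M .base) →
      GBase Sg Γ (.fix τ (lams τ.arity (apps (.const f) Ms))) τ

/-- Guarded terms: generated from closed guarded base terms, constants and
variables by application and λ-abstraction (equivalently: all `fix`-subterms
occur inside closed guarded base subterms). -/
inductive Guarded (Sg : Sig) : Tm → Prop
  | base {M τ} : GBase Sg [] M τ → Guarded Sg M
  | const {c} : Guarded Sg (.const c)
  | var {n} : Guarded Sg (.var n)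
  | app {M N} : Guarded Sg M → Guarded Sg N → Guarded Sg (.app M N)
  | lam {τ M} : Guarded Sg M → Guarded Sg (.lam τ M)

/-! ## Reduction and conversion -/

/-- One-step β/fix-reduction (compatible closure). -/
inductive Red : Tm → Tm → Prop
  | beta {τ M N} : Red (.app (.lam τ M) N) (Tm.subst 0 N M)
  | fixUnfold {τ M} : Red (.fix τ M) (Tm.subst 0 (.fix τ M) M)
  | appL {M M' N} : Red M M' → Red (.app M N) (.app M' N)
  | appR {M N N'} : Red N N' → Red (.app M N) (.app M N')
  | lam {τ M M'} : Red M M' → Red (.lam τ M) (.lam τ M')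
  | fixC {τ M M'} : Red M M' → Red (.fix τ M) (.fix τ M')

/-- Multi-step reduction `↠`. -/
def RedStar : Tm → Tm → Prop := Relation.ReflTransGen Red

/-- Convertibility: equivalence closure of reduction. -/
def Conv : Tm → Tm → Prop := Relation.EqvGen Red

/-- `fix`-freeness of a term. -/
def Tm.NoFix : Tm → Prop
  | .fix _ _ => False
  | .app M N => M.NoFix ∧ N.NoFix
  | .lam _ M => M.NoFix
  | _ => True

/-- Predicate signatures: a predicate name is assigned its list of argument types. -/
abbrev PSig : Type := String → Option (List Ty)
/-! ## Coterms and the complete Herbrand base -/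

/-- The polynomial functor `X ↦ ⟦Σ⟧(X) + V` of a first-order signature,
with a set `V` of variables. -/
def coSig (Sg : Sig) (V : Type) : PFunctor.{0} where
  A := String ⊕ V
  B := fun a => match a with
    | Sum.inl c => Fin (Sg.ar c)
    | Sum.inr _ => Empty

/-- Coterms over `Σ` and variables `V`: the final coalgebra (M-type) of
`⟦Σ⟧(-) + V`; `PFunctor.M.dest` is the structure map `root`. -/
def CoTerm (Sg : Sig) (V : Type) : Type := (coSig Sg V).M

/-- Ground coterms: the complete Herbrand universe. -/
abbrev GCoTerm (Sg : Sig) : Type := CoTerm Sg Empty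

/-- One step of the substitution coalgebra used to define `csubst`. -/
noncomputable def substStep {Sg : Sig} (θ : ℕ → GCoTerm Sg) :
    (CoTerm Sg ℕ ⊕ GCoTerm Sg) → (coSig Sg Empty).Obj (CoTerm Sg ℕ ⊕ GCoTerm Sg)
  | Sum.inl t =>
    match PFunctor.M.dest t with
    | ⟨Sum.inl f, k⟩ => ⟨Sum.inl f, fun i => Sum.inl (k i)⟩
    | ⟨Sum.inr v, _⟩ =>
      match PFunctor.M.dest (θ v) with
      | ⟨Sum.inl f, k⟩ => ⟨Sum.inl f, fun i => Sum.inr (k i)⟩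
      | ⟨Sum.inr e, _⟩ => e.elim
  | Sum.inr t =>
    match PFunctor.M.dest t with
    | ⟨Sum.inl f, k⟩ => ⟨Sum.inl f, fun i => Sum.inr (k i)⟩
    | ⟨Sum.inr e, _⟩ => e.elim

/-- Substitution of ground coterms for the variables of a coterm
(the Kleisli structure of the free completely iterative monad). -/
noncomputable def csubst {Sg : Sig} (t : CoTerm Sg ℕ) (θ : ℕ → GCoTerm Sg) : GCoTerm Sg :=
  PFunctor.M.corec (substStep θ) (Sum.inl t)

/-- The complete Herbrand base: atoms `p(t₁, …, tₙ)` over ground coterms. -/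
abbrev HBase (Sg : Sig) : Type := String × List (GCoTerm Sg)

/-- A specification of the coterm semantics `⟦-⟧` of (first-order guarded)
terms: it identifies convertible terms and sends a term to the tree determined
by its head normal forms. -/
def SemSpec (Sg : Sig) (sem : Tm → CoTerm Sg ℕ) : Prop :=
  (∀ M N, Conv M N → sem M = sem N) ∧
  (∀ M f Ns (h : Ns.length = Sg.ar f),
    (∀ N ∈ Ns, Guarded Sg N) →
    RedStar M (apps (.const f) Ns) →
    PFunctor.M.dest (sem M) = ⟨Sum.inl f, fun i => sem (Ns.get (Fin.cast h.symm i))⟩) ∧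
  (∀ M x, RedStar M (.var x) →
    PFunctor.M.dest (sem M) = ⟨Sum.inr x, fun e => e.elim⟩)

/-! ## Atoms, Horn clauses and the Herbrand model -/

/-- Syntactic atoms `p M₁ … Mₙ`. -/
structure Atm : Type where
  p : String
  args : List Tm

/-- The element `⟦A⟧[θ]` of the Herbrand base determined by an atom `A`, the
coterm semantics `sem` of terms and a ground substitution `θ`. -/
noncomputable def Atm.gsem {Sg : Sig} (sem : Tm → CoTerm Sg ℕ) (θ : ℕ → GCoTerm Sg)
    (A : Atm) : HBase Sg :=
  (A.p, A.args.map fun M => csubst (sem M) θ)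

/-- A clause `∀x₁ … x_n. A₁ ∧ … ∧ A_q → A₀` (de Bruijn: the variables of the
atoms range over `0, …, n-1`). -/
structure HClause : Type where
  n : ℕ
  body : List Atm
  head : Atm

/-- Well-formedness of a guarded first-order atom in a context of `n`
base-typed variables. -/
def Atm.WFg (Sg : Sig) (Pg : PSig) (n : ℕ) (A : Atm) : Prop :=
  ∃ τs, Pg A.p = some τs ∧ (∀ τ ∈ τs, τ = Ty.base) ∧
    List.Forall₂ (fun M τ => Guarded Sg M ∧ HasTy Sg (List.replicate n .base) M τ)
      A.args τs

/-- `H^g`-formulae: clauses whose atoms are first-order guarded atoms. -/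
def HClause.WFg (Sg : Sig) (Pg : PSig) (C : HClause) : Prop :=
  C.head.WFg Sg Pg C.n ∧ ∀ A ∈ C.body, A.WFg Sg Pg C.n

/-- Well-formedness of a fix-free (simple) first-order atom. -/
def Atm.WFh (Sg : Sig) (Pg : PSig) (n : ℕ) (A : Atm) : Prop :=
  (∀ M ∈ A.args, Tm.NoFix M) ∧ A.WFg Sg Pg n

/-- `H`-formulae: Horn clauses with fix-free first-order atoms. -/
def HClause.WFh (Sg : Sig) (Pg : PSig) (C : HClause) : Prop :=
  C.head.WFh Sg Pg C.n ∧ ∀ A ∈ C.body, A.WFh Sg Pg C.n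

/-- The monotone operator `Φ_P` on interpretations `I ⊆ 𝔅` determined by a
set `P` of clauses. -/
noncomputable def PhiP {Sg : Sig} (P : Set HClause) (sem : Tm → CoTerm Sg ℕ)
    (I : Set (HBase Sg)) : Set (HBase Sg) :=
  { a | ∃ C ∈ P, ∃ θ : ℕ → GCoTerm Sg,
      a = C.head.gsem sem θ ∧ ∀ B ∈ C.body, B.gsem sem θ ∈ I }

theorem PhiP_mono {Sg : Sig} (P : Set HClause) (sem : Tm → CoTerm Sg ℕ) :
    Monotone (PhiP P sem) := by
  intro I J hIJ a ha
  obtain ⟨C, hC, θ, ha, hb⟩ := ha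
  exact ⟨C, hC, θ, ha, fun B hB => hIJ (hb B hB)⟩

/-- The complete Herbrand model `M(P)`: the greatest fixed point of `Φ_P`. -/
noncomputable def HModel {Sg : Sig} (P : Set HClause) (sem : Tm → CoTerm Sg ℕ) :
    Set (HBase Sg) :=
  OrderHom.gfp ⟨PhiP P sem, PhiP_mono P sem⟩

/-! ## Simultaneous substitution and the annotated proof system -/

/-- Lifting of a simultaneous substitution under a binder. -/
def liftSub (ρ : ℕ → Tm) : ℕ → Tm
  | 0 => .var 0
  | n + 1 => Tm.shift 1 0 (ρ n)

/-- Simultaneous substitution in a term. -/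
def Tm.msub : (ℕ → Tm) → Tm → Tm
  | ρ, .var n => ρ n
  | _, .const c => .const c
  | ρ, .app M N => .app (Tm.msub ρ M) (Tm.msub ρ N)
  | ρ, .lam τ M => .lam τ (Tm.msub (liftSub ρ) M)
  | ρ, .fix τ M => .fix τ (Tm.msub (liftSub ρ) M)

/-- Instantiation of an atom by a substitution. -/
def Atm.sub (ρ : ℕ → Tm) (A : Atm) : Atm := ⟨A.p, A.args.map (Tm.msub ρ)⟩

/-- Convertibility of atoms. -/
def AtmConv (A B : Atm) : Prop := A.p = B.p ∧ List.Forall₂ Conv A.args B.args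

mutual
/-- Derivations of atomic goals in the CUP proof `π` above the initial
`CoFix`/`∀R⟨⟩`/`→R⟨⟩` steps, over the program `P`, the coinduction hypothesis
(`H^g`-clause) `φC` — whose `φC.n` universally quantified variables have been
replaced by eigenvariables, here the de Bruijn variables `0, …, φC.n - 1` —
and its hypotheses `φC.body` (the set `hp`).  The judgement is annotated with
the set `D` of atoms proven in the derivation and the set `Ag` of agents, i.e.
the (semantic) substitutions with which the coinduction hypothesis `φC` is
used via the Decide rule. -/
inductive AUni (Sg : Sig) (P : Set HClause) (φC : HClause) (sem : Tm → CoTerm Sg ℕ) :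
    Set Atm → Set (ℕ → CoTerm Sg ℕ) → Atm → Prop
  /-- Backchaining on a program clause `C ∈ P`
  (Decide/DecideG followed by `∀L`, `→L`, `Init`). -/
  | byClause {D Ag A C ρ} : C ∈ P →
      (∀ j < C.n, GBase Sg (List.replicate φC.n Ty.base) (ρ j) Ty.base) →
      AtmConv A (C.head.sub ρ) →
      AUniList Sg P φC sem D Ag (C.body.map (Atm.sub ρ)) →
      AUni Sg P φC sem (insert A D) Ag A
  /-- Resolving against one of the hypotheses `hp` of the coinduction goal. -/
  | byHyp {A B} : B ∈ φC.body → AtmConv A B → AUni Sg P φC sem {A} ∅ A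
  /-- Resolving against the coinduction hypothesis `φC` with instantiation `ρ`;
  this records the corresponding agent `⟦ρ⟧` in the annotation. -/
  | byCoind {D Ag A ρ} :
      (∀ j < φC.n, GBase Sg (List.replicate φC.n Ty.base) (ρ j) Ty.base) →
      AtmConv A (φC.head.sub ρ) →
      AUniList Sg P φC sem D Ag (φC.body.map (Atm.sub ρ)) →
      AUni Sg P φC sem (insert A D) (insert (fun j => sem (ρ j)) Ag) A

/-- Derivations of lists of atomic goals (`∧R`), with annotations unioned. -/
inductive AUniList (Sg : Sig) (P : Set HClause) (φC : HClause) (sem : Tm → CoTerm Sg ℕ) :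
    Set Atm → Set (ℕ → CoTerm Sg ℕ) → List Atm → Prop
  | nil : AUniList Sg P φC sem ∅ ∅ []
  | cons {D Ag D' Ag' A As} : AUni Sg P φC sem D Ag A →
      AUniList Sg P φC sem D' Ag' As →
      AUniList Sg P φC sem (D ∪ D') (Ag ∪ Ag') (A :: As)
end

/-- The root of the CUP proof `π` of `Σ; P ⊢co φC`: after `CoFix`, `∀R⟨⟩` and
`→R⟨⟩`, the guarded goal `⟨A₀[c⃗/x⃗]⟩` must be resolved (`Decide⟨⟩`) against a
clause of the original program `P`; `D` and `Ag` collect the proven atoms and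
the agents of the whole proof. -/
def AGua (Sg : Sig) (P : Set HClause) (φC : HClause) (sem : Tm → CoTerm Sg ℕ)
    (D : Set Atm) (Ag : Set (ℕ → CoTerm Sg ℕ)) : Prop :=
  ∃ C ∈ P, ∃ ρ : ℕ → Tm,
    (∀ j < C.n, GBase Sg (List.replicate φC.n Ty.base) (ρ j) Ty.base) ∧
    AtmConv φC.head (C.head.sub ρ) ∧
    ∃ D' Ag', AUniList Sg P φC sem D' Ag' (C.body.map (Atm.sub ρ)) ∧
      D = insert φC.head D' ∧ Ag = Ag'

/-- `I` is an invariant for `K`: `K ⊆ I` and `I` is a `Φ_P`-invariant. -/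
def IsInv {Sg : Sig} (P : Set HClause) (sem : Tm → CoTerm Sg ℕ)
    (K I : Set (HBase Sg)) : Prop :=
  K ⊆ I ∧ I ⊆ PhiP P sem I

/-- `Θ` turns a substitution identifier (a list over `{1, …, m}`) into a ground
substitution, by iterated Kleisli composition of agents from the right:
`Θ(ε) = θ₀` and `Θ(w:k) = Θ(w) ⊙ θ_k`. -/
noncomputable def Theta {Sg : Sig} {m : ℕ} (θ₀ : ℕ → GCoTerm Sg)
    (ag : Fin m → (ℕ → CoTerm Sg ℕ)) : List (Fin m) → (ℕ → GCoTerm Sg)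
  | [] => θ₀
  | k :: w => fun j => csubst (ag k j) (Theta θ₀ ag w)

/-! ## Helper material for the proof -/

section Helpers

/-! ### de Bruijn infrastructure -/

def upr (ξ : ℕ → ℕ) : ℕ → ℕ
  | 0 => 0
  | n + 1 => ξ n + 1

def Tm.ren : (ℕ → ℕ) → Tm → Tm
  | ξ, .var n => .var (ξ n)
  | _, .const c => .const c
  | ξ, .app M N => .app (Tm.ren ξ M) (Tm.ren ξ N)
  | ξ, .lam τ M => .lam τ (Tm.ren (upr ξ) M)
  | ξ, .fix τ M => .fix τ (Tm.ren (upr ξ) M)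

def shf (d c : ℕ) : ℕ → ℕ := fun n => if n < c then n else n + d

theorem upr_shf (d c : ℕ) : upr (shf d c) = shf d (c + 1) := by
  funext n
  cases n with
  | zero => simp [upr, shf]
  | succ n => simp only [upr, shf]; split_ifs <;> omega

theorem shift_eq_ren (d : ℕ) (M : Tm) : ∀ c, Tm.shift d c M = Tm.ren (shf d c) M := by
  induction M with
  | var n => intro c; simp only [Tm.shift, Tm.ren, shf]; split_ifs <;> rfl
  | const => intro c; rfl
  | app M N ihM ihN => intro c; simp [Tm.shift, Tm.ren, ihM, ihN]
  | lam τ M ih => intro c; simp [Tm.shift, Tm.ren, ih, upr_shf]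
  | fix τ M ih => intro c; simp [Tm.shift, Tm.ren, ih, upr_shf]

theorem shift10 (M : Tm) : Tm.shift 1 0 M = Tm.ren Nat.succ M := by
  rw [shift_eq_ren]
  congr 1

theorem upr_comp (ξ ζ : ℕ → ℕ) : upr (fun n => ξ (ζ n)) = fun n => upr ξ (upr ζ n) := by
  funext n; cases n <;> rfl

theorem ren_ren (M : Tm) : ∀ ξ ζ : ℕ → ℕ,
    Tm.ren ξ (Tm.ren ζ M) = Tm.ren (fun n => ξ (ζ n)) M := by
  induction M with
  | var n => intros; rfl
  | const => intros; rfl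
  | app M N ihM ihN => intros; simp [Tm.ren, ihM, ihN]
  | lam τ M ih => intros; simp [Tm.ren, ih, upr_comp]
  | fix τ M ih => intros; simp [Tm.ren, ih, upr_comp]

theorem lift_var_comp (ξ : ℕ → ℕ) :
    liftSub (fun n => Tm.var (ξ n)) = fun n => Tm.var (upr ξ n) := by
  funext n; cases n <;> simp [liftSub, upr, Tm.shift]

theorem ren_eq_msub (M : Tm) : ∀ ξ : ℕ → ℕ, Tm.ren ξ M = Tm.msub (fun n => .var (ξ n)) M := by
  induction M with
  | var n => intros; rfl
  | const => intros; rfl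
  | app M N ihM ihN => intros; simp [Tm.ren, Tm.msub, ihM, ihN]
  | lam τ M ih => intros; simp [Tm.ren, Tm.msub, ih, lift_var_comp]
  | fix τ M ih => intros; simp [Tm.ren, Tm.msub, ih, lift_var_comp]

theorem lift_ren (ρ : ℕ → Tm) (ξ : ℕ → ℕ) :
    liftSub (fun n => ρ (ξ n)) = fun n => liftSub ρ (upr ξ n) := by
  funext n; cases n <;> rfl

theorem msub_ren (M : Tm) : ∀ (ρ : ℕ → Tm) (ξ : ℕ → ℕ),
    Tm.msub ρ (Tm.ren ξ M) = Tm.msub (fun n => ρ (ξ n)) M := by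
  induction M with
  | var n => intros; rfl
  | const => intros; rfl
  | app M N ihM ihN => intros; simp [Tm.ren, Tm.msub, ihM, ihN]
  | lam τ M ih => intros; simp [Tm.ren, Tm.msub, ih, lift_ren]
  | fix τ M ih => intros; simp [Tm.ren, Tm.msub, ih, lift_ren]

theorem ren_lift (ρ : ℕ → Tm) (ξ : ℕ → ℕ) :
    liftSub (fun n => Tm.ren ξ (ρ n)) = fun n => Tm.ren (upr ξ) (liftSub ρ n) := by
  funext n
  cases n with
  | zero => rfl
  | succ n => simp only [liftSub, shift10, ren_ren]; rfl

theorem ren_msub (M : Tm) : ∀ (ξ : ℕ → ℕ) (ρ : ℕ → Tm),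
    Tm.ren ξ (Tm.msub ρ M) = Tm.msub (fun n => Tm.ren ξ (ρ n)) M := by
  induction M with
  | var n => intros; rfl
  | const => intros; rfl
  | app M N ihM ihN => intros; simp [Tm.ren, Tm.msub, ihM, ihN]
  | lam τ M ih => intros; simp [Tm.ren, Tm.msub, ih, ren_lift]
  | fix τ M ih => intros; simp [Tm.ren, Tm.msub, ih, ren_lift]

theorem lift_msub (ρ ρ' : ℕ → Tm) :
    liftSub (fun n => Tm.msub ρ (ρ' n)) = fun n => Tm.msub (liftSub ρ) (liftSub ρ' n) := by
  funext n
  cases n with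
  | zero => rfl
  | succ n => simp only [liftSub, shift10, ren_msub, msub_ren]

theorem msub_msub (M : Tm) : ∀ (ρ ρ' : ℕ → Tm),
    Tm.msub ρ (Tm.msub ρ' M) = Tm.msub (fun n => Tm.msub ρ (ρ' n)) M := by
  induction M with
  | var n => intros; rfl
  | const => intros; rfl
  | app M N ihM ihN => intros; simp [Tm.msub, ihM, ihN]
  | lam τ M ih => intros; simp [Tm.msub, ih, lift_msub]
  | fix τ M ih => intros; simp [Tm.msub, ih, lift_msub]

theorem lift_var : liftSub Tm.var = Tm.var := by
  funext n; cases n <;> simp [liftSub, Tm.shift]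

theorem msub_var (M : Tm) : Tm.msub Tm.var M = M := by
  induction M with
  | var n => rfl
  | const => rfl
  | app M N ihM ihN => simp [Tm.msub, ihM, ihN]
  | lam τ M ih => simp [Tm.msub, ih, lift_var]
  | fix τ M ih => simp [Tm.msub, ih, lift_var]

def subSub (k : ℕ) (N : Tm) : ℕ → Tm := fun n =>
  if n = k then Tm.shift k 0 N else if k < n then .var (n - 1) else .var n

theorem lift_subSub (k : ℕ) (N : Tm) : liftSub (subSub k N) = subSub (k + 1) N := by
  funext n
  cases n with
  | zero => simp [liftSub, subSub]
  | succ n =>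
    simp only [liftSub, subSub, add_left_inj, add_lt_add_iff_right]
    split_ifs with h1 h2
    · rw [shift10, shift_eq_ren, shift_eq_ren, ren_ren]
      congr 1
    · simp [Tm.shift]; omega
    · simp [Tm.shift]

theorem subst_eq_msub (N M : Tm) : ∀ k, Tm.subst k N M = Tm.msub (subSub k N) M := by
  induction M with
  | var n => intros; rfl
  | const => intros; rfl
  | app M N ihM ihN => intros; simp [Tm.subst, Tm.msub, ihM, ihN]
  | lam τ M ih => intros; simp [Tm.subst, Tm.msub, ih, lift_subSub]
  | fix τ M ih => intros; simp [Tm.subst, Tm.msub, ih, lift_subSub]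

def scons (N : Tm) (ρ : ℕ → Tm) : ℕ → Tm
  | 0 => N
  | n + 1 => ρ n

theorem subSub_zero (N : Tm) : subSub 0 N = scons N Tm.var := by
  funext n
  cases n with
  | zero =>
    simp only [subSub, scons, if_true, shift_eq_ren, ren_eq_msub]
    conv_rhs => rw [← msub_var N]
    congr 1
  | succ n => simp [subSub, scons]

theorem subst_zero (N M : Tm) : Tm.subst 0 N M = Tm.msub (scons N Tm.var) M := by
  rw [subst_eq_msub, subSub_zero]

theorem subst_lift (N M : Tm) (ρ : ℕ → Tm) :
    Tm.subst 0 N (Tm.msub (liftSub ρ) M) = Tm.msub (scons N ρ) M := by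
  rw [subst_zero, msub_msub]
  congr 1
  funext n
  cases n with
  | zero => rfl
  | succ n =>
    simp only [liftSub, shift10, msub_ren, scons]
    exact msub_var _

theorem msub_subst (ρ : ℕ → Tm) (N M : Tm) :
    Tm.msub ρ (Tm.subst 0 N M) = Tm.subst 0 (Tm.msub ρ N) (Tm.msub (liftSub ρ) M) := by
  rw [subst_lift, subst_zero, msub_msub]
  congr 1
  funext n
  cases n <;> rfl

/-! ### Reduction -/

theorem Red.msub {M N : Tm} (h : Red M N) : ∀ ρ, Red (Tm.msub ρ M) (Tm.msub ρ N) := by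
  induction h with
  | beta => intro ρ; rw [msub_subst]; exact Red.beta
  | fixUnfold => intro ρ; rw [msub_subst]; exact Red.fixUnfold
  | appL _ ih => intro ρ; exact Red.appL (ih ρ)
  | appR _ ih => intro ρ; exact Red.appR (ih ρ)
  | lam _ ih => intro ρ; exact Red.lam (ih _)
  | fixC _ ih => intro ρ; exact Red.fixC (ih _)

theorem RedStar.toConv {M N : Tm} (h : RedStar M N) : Conv M N := by
  unfold RedStar at h
  induction h with
  | refl => exact Relation.EqvGen.refl _
  | tail _ h2 ih => exact Relation.EqvGen.trans _ _ _ ih (Relation.EqvGen.rel _ _ h2)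

theorem RedStar.msub {M N : Tm} (h : RedStar M N) (ρ : ℕ → Tm) :
    RedStar (Tm.msub ρ M) (Tm.msub ρ N) := by
  unfold RedStar at h
  induction h with
  | refl => exact Relation.ReflTransGen.refl
  | tail _ h2 ih => exact Relation.ReflTransGen.tail ih (Red.msub h2 ρ)

theorem RedStar.appL {M M' : Tm} (h : RedStar M M') (N : Tm) :
    RedStar (.app M N) (.app M' N) := by
  unfold RedStar at h
  induction h with
  | refl => exact Relation.ReflTransGen.refl
  | tail _ h2 ih => exact Relation.ReflTransGen.tail ih (Red.appL h2)

theorem RedStar.appR {N N' : Tm} (M : Tm) (h : RedStar N N') :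
    RedStar (.app M N) (.app M N') := by
  unfold RedStar at h
  induction h with
  | refl => exact Relation.ReflTransGen.refl
  | tail _ h2 ih => exact Relation.ReflTransGen.tail ih (Red.appR h2)

theorem Conv.map {F : Tm → Tm} (hF : ∀ M N, Red M N → Red (F M) (F N)) {M N : Tm}
    (h : Conv M N) : Conv (F M) (F N) := by
  unfold Conv at h
  induction h with
  | rel _ _ h => exact Relation.EqvGen.rel _ _ (hF _ _ h)
  | refl => exact Relation.EqvGen.refl _
  | symm _ _ _ ih => exact Relation.EqvGen.symm _ _ ih
  | trans _ _ _ _ _ ih1 ih2 => exact Relation.EqvGen.trans _ _ _ ih1 ih2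

theorem Conv.app {M M' N N' : Tm} (h1 : Conv M M') (h2 : Conv N N') :
    Conv (.app M N) (.app M' N') :=
  Relation.EqvGen.trans _ _ _ (Conv.map (F := fun X => .app X N) (fun _ _ => Red.appL) h1)
    (Conv.map (F := fun X => .app M' X) (fun _ _ => Red.appR) h2)

theorem Red.apps {M M' : Tm} (h : Red M M') (Ns : List Tm) : Red (apps M Ns) (apps M' Ns) := by
  induction Ns generalizing M M' with
  | nil => exact h
  | cons N Ns ih => exact ih (Red.appL h)

theorem Conv.apps {Ns Ns' : List Tm} (hN : List.Forall₂ Conv Ns Ns') :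
    ∀ {M M' : Tm}, Conv M M' → Conv (apps M Ns) (apps M' Ns') := by
  induction hN with
  | nil => intro M M' h; exact h
  | cons h _ ih => intro M M' h'; exact ih (Conv.app h' h)

theorem msub_apps (ρ : ℕ → Tm) (Ns : List Tm) : ∀ M,
    Tm.msub ρ (apps M Ns) = apps (Tm.msub ρ M) (Ns.map (Tm.msub ρ)) := by
  induction Ns with
  | nil => intro M; rfl
  | cons N Ns ih => intro M; simp [apps, ih, Tm.msub]

def liftN : ℕ → (ℕ → Tm) → (ℕ → Tm)
  | 0, ρ => ρ
  | k + 1, ρ => liftN k (liftSub ρ)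

theorem msub_lams (k : ℕ) : ∀ (ρ : ℕ → Tm) (M : Tm),
    Tm.msub ρ (lams k M) = lams k (Tm.msub (liftN k ρ) M) := by
  induction k with
  | zero => intros; rfl
  | succ k ih => intro ρ M; simp [lams, Tm.msub, ih, liftN]

def consN : List Tm → (ℕ → Tm) → (ℕ → Tm)
  | [], ρ => ρ
  | N :: Ns, ρ => consN Ns (scons N ρ)

theorem multibeta (B : Tm) (Ns : List Tm) : ∀ ρ : ℕ → Tm,
    RedStar (apps (Tm.msub ρ (lams Ns.length B)) Ns) (Tm.msub (consN Ns ρ) B) := by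
  induction Ns with
  | nil => intro ρ; exact Relation.ReflTransGen.refl
  | cons N Ns ih =>
    intro ρ
    refine Relation.ReflTransGen.head ?_ (ih (scons N ρ))
    have := Red.apps (Red.beta (τ := .base) (M := Tm.msub (liftSub ρ) (lams Ns.length B)) (N := N)) Ns
    rw [subst_lift] at this
    exact this


/-! ### Guarded base terms: renaming and substitution -/

def uprN : ℕ → (ℕ → ℕ) → (ℕ → ℕ)
  | 0, ξ => ξ
  | k + 1, ξ => uprN k (upr ξ)

theorem ren_lams (k : ℕ) : ∀ (ξ : ℕ → ℕ) (M : Tm),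
    Tm.ren ξ (lams k M) = lams k (Tm.ren (uprN k ξ) M) := by
  induction k with
  | zero => intros; rfl
  | succ k ih => intro ξ M; simp [lams, Tm.ren, ih, uprN]

theorem ren_apps (ξ : ℕ → ℕ) (Ns : List Tm) : ∀ M,
    Tm.ren ξ (apps M Ns) = apps (Tm.ren ξ M) (Ns.map (Tm.ren ξ)) := by
  induction Ns with
  | nil => intro M; rfl
  | cons N Ns ih => intro M; simp [apps, ih, Tm.ren]

def GRen (Γ Δ : Ctx) (ξ : ℕ → ℕ) : Prop := ∀ i τ, Γ[i]? = some τ → Δ[ξ i]? = some τ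

theorem GRen.upr {Γ Δ ξ} (h : GRen Γ Δ ξ) (σ : Ty) : GRen (σ :: Γ) (σ :: Δ) (upr ξ) := by
  intro i τ hi
  cases i with
  | zero => simpa [_root_.upr] using hi
  | succ i => simpa [_root_.upr] using h i τ (by simpa using hi)

theorem replicate_shift (k : ℕ) (σ : Ty) (Γ : Ctx) :
    List.replicate (k + 1) σ ++ Γ = List.replicate k σ ++ σ :: Γ := by
  rw [List.replicate_succ']; simp

theorem GRen.uprN (k : ℕ) (σ : Ty) : ∀ {Γ Δ ξ}, GRen Γ Δ ξ →
    GRen (List.replicate k σ ++ Γ) (List.replicate k σ ++ Δ) (uprN k ξ) := by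
  induction k with
  | zero => intro Γ Δ ξ h; simpa [_root_.uprN] using h
  | succ k ih =>
    intro Γ Δ ξ h
    rw [replicate_shift, replicate_shift]
    exact ih (h.upr σ)

theorem GBase.ren {Sg : Sig} {Γ M τ} (h : GBase Sg Γ M τ) :
    ∀ {Δ ξ}, GRen Γ Δ ξ → GBase Sg Δ (Tm.ren ξ M) τ := by
  induction h with
  | var h1 h2 => intro Δ ξ h; exact GBase.var (h _ _ h1) h2
  | const h1 => intro Δ ξ h; exact GBase.const h1
  | app _ _ ih1 ih2 => intro Δ ξ h; exact GBase.app (ih1 h) (ih2 h)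
  | @fixI Γ f σf τ Ms h1 h2 h3 h4 ih =>
    intro Δ ξ h
    simp only [Tm.ren, ren_lams, ren_apps]
    refine GBase.fixI h1 h2 (by simpa using h3) ?_
    intro M hM
    obtain ⟨M', hM', rfl⟩ := List.mem_map.1 hM
    exact ih M' hM' ((h.upr τ).uprN _ _)

def GSub (Sg : Sig) (Γ Δ : Ctx) (ρ : ℕ → Tm) : Prop :=
  ∀ i τ, Γ[i]? = some τ → τ.order ≤ 1 → GBase Sg Δ (ρ i) τ

theorem GSub.lift {Sg Γ Δ ρ} (h : GSub Sg Γ Δ ρ) (σ : Ty) :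
    GSub Sg (σ :: Γ) (σ :: Δ) (liftSub ρ) := by
  intro i τ hi ho
  cases i with
  | zero => exact GBase.var (by simpa using hi) ho
  | succ i =>
    simp only [liftSub, shift10]
    refine (h i τ (by simpa using hi) ho).ren ?_
    intro j τ' hj
    simpa using hj

theorem GSub.liftN {Sg} (k : ℕ) (σ : Ty) : ∀ {Γ Δ ρ}, GSub Sg Γ Δ ρ →
    GSub Sg (List.replicate k σ ++ Γ) (List.replicate k σ ++ Δ) (liftN k ρ) := by
  induction k with
  | zero => intro Γ Δ ρ h; simpa [_root_.liftN] using h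
  | succ k ih =>
    intro Γ Δ ρ h
    rw [replicate_shift, replicate_shift]
    exact ih (h.lift σ)

theorem GBase.msub {Sg : Sig} {Γ M τ} (h : GBase Sg Γ M τ) :
    ∀ {Δ ρ}, GSub Sg Γ Δ ρ → GBase Sg Δ (Tm.msub ρ M) τ := by
  induction h with
  | var h1 h2 => intro Δ ρ h; exact h _ _ h1 h2
  | const h1 => intro Δ ξ h; exact GBase.const h1
  | app _ _ ih1 ih2 => intro Δ ξ h; exact GBase.app (ih1 h) (ih2 h)
  | @fixI Γ f σf τ Ms h1 h2 h3 h4 ih =>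
    intro Δ ρ h
    simp only [Tm.msub, msub_lams, msub_apps]
    refine GBase.fixI h1 h2 (by simpa using h3) ?_
    intro M hM
    obtain ⟨M', hM', rfl⟩ := List.mem_map.1 hM
    exact ih M' hM' ((h.lift τ).liftN _ _)

theorem liftSub_agree {ρ ρ' : ℕ → Tm} {n : ℕ} (h : ∀ i < n, ρ i = ρ' i) :
    ∀ i < n + 1, liftSub ρ i = liftSub ρ' i := by
  intro i hi
  cases i with
  | zero => rfl
  | succ i => simp [liftSub, h i (by omega)]

theorem liftN_agree (k : ℕ) : ∀ {ρ ρ' : ℕ → Tm} {n : ℕ}, (∀ i < n, ρ i = ρ' i) →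
    ∀ i < k + n, liftN k ρ i = liftN k ρ' i := by
  induction k with
  | zero => intro ρ ρ' n h i hi; exact h i (by omega)
  | succ k ih => intro ρ ρ' n h i hi; exact ih (liftSub_agree h) i (by omega)

theorem liftN_var (k : ℕ) : liftN k Tm.var = Tm.var := by
  induction k with
  | zero => rfl
  | succ k ih => simp [liftN, lift_var, ih]

theorem GBase.agree {Sg : Sig} {Γ M τ} (h : GBase Sg Γ M τ) :
    ∀ {ρ ρ' : ℕ → Tm}, (∀ i < Γ.length, ρ i = ρ' i) → Tm.msub ρ M = Tm.msub ρ' M := by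
  induction h with
  | var h1 h2 => intro ρ ρ' h; exact h _ (List.getElem?_eq_some_iff.1 h1).1
  | const h1 => intro ρ ρ' h; rfl
  | app _ _ ih1 ih2 => intro ρ ρ' h; simp [Tm.msub, ih1 h, ih2 h]
  | @fixI Γ f σf τ Ms h1 h2 h3 h4 ih =>
    intro ρ ρ' h
    simp only [Tm.msub, msub_lams, msub_apps]
    have : Ms.map (Tm.msub (liftN τ.arity (liftSub ρ))) =
        Ms.map (Tm.msub (liftN τ.arity (liftSub ρ'))) := by
      refine List.map_congr_left fun M hM => ih M hM ?_
      intro i hi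
      exact liftN_agree _ (liftSub_agree h) i (by simpa using hi)
    rw [this]

theorem GBase.order {Sg : Sig} (hSg : Sg.FirstOrder) {Γ M τ} (h : GBase Sg Γ M τ) :
    τ.order ≤ 1 := by
  induction h with
  | var _ h => exact h
  | const h => exact hSg _ _ h
  | app _ _ ih _ => simp only [Ty.order] at ih; omega
  | fixI _ h => exact h

theorem Ty.base_of_order {σ : Ty} (h : σ.order = 0) : σ = .base := by
  cases σ with
  | base => rfl
  | arrow a b => simp [Ty.order] at h

theorem GBase.arrow_base {Sg : Sig} (hSg : Sg.FirstOrder) {Γ M σ τ}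
    (h : GBase Sg Γ M (.arrow σ τ)) : σ = .base := by
  have := h.order hSg
  simp only [Ty.order] at this
  exact Ty.base_of_order (by omega)

theorem GSub.scons {Sg Γ Δ ρ N σ} (h : GSub Sg Γ Δ ρ) (hN : GBase Sg Δ N σ) :
    GSub Sg (σ :: Γ) Δ (scons N ρ) := by
  intro i τ hi ho
  cases i with
  | zero => simp at hi; subst hi; exact hN
  | succ i => exact h i τ (by simpa using hi) ho

theorem GSub.consN {Sg Δ} (Ns : List Tm) : ∀ {Γ ρ}, GSub Sg Γ Δ ρ →
    (∀ N ∈ Ns, GBase Sg Δ N .base) →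
    GSub Sg (List.replicate Ns.length Ty.base ++ Γ) Δ (consN Ns ρ) := by
  induction Ns with
  | nil => intro Γ ρ h _; simpa [_root_.consN] using h
  | cons N Ns ih =>
    intro Γ ρ h hN
    rw [List.length_cons, replicate_shift]
    exact ih (h.scons (hN N (by simp))) (fun N hN' => hN N (by simp [hN']))

theorem GSub.var {Sg Γ} : GSub Sg Γ Γ Tm.var := fun _ _ hi ho => GBase.var hi ho

theorem replicate_getElem? {n i : ℕ} {τ : Ty}
    (h : (List.replicate n Ty.base)[i]? = some τ) : i < n ∧ τ = .base := by
  rw [List.getElem?_replicate] at h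
  split_ifs at h with h'
  exact ⟨h', by simpa using h.symm⟩

theorem GSub.ofBase {Sg n Δ ρ} (h : ∀ j < n, GBase Sg Δ (ρ j) .base) :
    GSub Sg (List.replicate n .base) Δ ρ := by
  intro i τ hi _
  obtain ⟨h1, rfl⟩ := replicate_getElem? hi
  exact h i h1

/-! ### Head normal forms of guarded base terms -/

theorem fix_red {τ : Ty} {f : String} {Ms Ns : List Tm} (h : Ns.length = τ.arity) :
    RedStar (apps (.fix τ (lams τ.arity (apps (.const f) Ms))) Ns)
      (apps (.const f) (Ms.map (Tm.msub (consN Ns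
        (scons (.fix τ (lams τ.arity (apps (.const f) Ms))) Tm.var))))) := by
  refine Relation.ReflTransGen.head (Red.apps Red.fixUnfold Ns) ?_
  rw [subst_zero]
  have := multibeta (apps (.const f) Ms) Ns
    (scons (.fix τ (lams τ.arity (apps (.const f) Ms))) Tm.var)
  rw [msub_apps, h] at this
  exact this

theorem GBase.hnf_apps {Sg : Sig} (hSg : Sg.FirstOrder) {Γ M τ} (h : GBase Sg Γ M τ) :
    ∀ n, Γ = List.replicate n .base → ∀ Ns : List Tm, Ns.length = τ.arity →
    (∀ N ∈ Ns, GBase Sg Γ N .base) →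
    (∃ j, RedStar (apps M Ns) (.var j)) ∨
    (∃ f Ns', Ns'.length = Sg.ar f ∧ (∀ N ∈ Ns', GBase Sg Γ N .base) ∧
      RedStar (apps M Ns) (apps (.const f) Ns')) := by
  induction h with
  | @var Γ i τ h1 h2 =>
    rintro n rfl Ns hl hNs
    obtain ⟨_, rfl⟩ := replicate_getElem? h1
    simp [Ty.arity] at hl
    subst hl
    exact Or.inl ⟨i, Relation.ReflTransGen.refl⟩
  | @const Γ c τ h1 =>
    intro n hn Ns hl hNs
    exact Or.inr ⟨c, Ns, by simp [Sig.ar, h1, hl], hNs, Relation.ReflTransGen.refl⟩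
  | @app Γ M N σ τ h1 h2 ih1 ih2 =>
    intro n hn Ns hl hNs
    have hb := h1.arrow_base hSg
    subst hb
    refine ih1 n hn (N :: Ns) (by simp [Ty.arity, hl]) ?_
    intro N' hN'
    rcases List.mem_cons.1 hN' with rfl | h
    · exact h2
    · exact hNs _ h
  | @fixI Γ f σf τ Ms h1 h2 h3 h4 ih =>
    intro n hn Ns hl hNs
    refine Or.inr ⟨f, _, ?_, ?_, fix_red hl⟩
    · simp [Sig.ar, h1, h3]
    · intro M hM
      obtain ⟨M', hM', rfl⟩ := List.mem_map.1 hM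
      refine (h4 M' hM').msub ?_
      have := GSub.consN Ns (GSub.var.scons (GBase.fixI h1 h2 h3 h4)) hNs
      rw [hl] at this
      exact this

theorem GBase.hnf {Sg : Sig} (hSg : Sg.FirstOrder) {n M}
    (h : GBase Sg (List.replicate n .base) M .base) :
    (∃ j, RedStar M (.var j)) ∨
    (∃ f Ns, Ns.length = Sg.ar f ∧ (∀ N ∈ Ns, GBase Sg (List.replicate n .base) N .base) ∧
      RedStar M (apps (.const f) Ns)) :=
  h.hnf_apps hSg n rfl [] rfl (by simp)

/-! ### Guarded base terms over base contexts are convertible to guarded terms -/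

def arrows : ℕ → Ty → Ty
  | 0, τ => τ
  | n + 1, τ => .arrow .base (arrows n τ)

theorem arrows_arity (n : ℕ) (τ : Ty) : (arrows n τ).arity = n + τ.arity := by
  induction n with
  | zero => simp [arrows]
  | succ n ih => simp [arrows, Ty.arity, ih]; omega

theorem arrows_order (n : ℕ) {τ : Ty} (h : τ.order ≤ 1) : (arrows n τ).order ≤ 1 := by
  induction n with
  | zero => simpa [arrows]
  | succ n ih => simp [arrows, Ty.order, ih]

theorem lams_add (n k : ℕ) (M : Tm) : lams (n + k) M = lams n (lams k M) := by
  induction n with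
  | zero => simp [lams]
  | succ n ih => rw [Nat.succ_add]; simp [lams, ih]

/-- `[var (n-1), …, var 0]` -/
def vlist : ℕ → List Tm
  | 0 => []
  | n + 1 => .var n :: vlist n

theorem vlist_length (n : ℕ) : (vlist n).length = n := by
  induction n with
  | zero => rfl
  | succ n ih => simp [vlist, ih]

theorem consN_vlist (n : ℕ) : ∀ (ρ : ℕ → Tm) (l : ℕ), (∀ i < l, ρ i = .var (n + i)) →
    ∀ i < n + l, consN (vlist n) ρ i = .var i := by
  induction n with
  | zero => intro ρ l h i hi; simpa [vlist, consN] using h i (by omega)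
  | succ n ih =>
    intro ρ l h i hi
    refine ih (scons (.var n) ρ) (l + 1) ?_ i (by omega)
    intro i hi
    cases i with
    | zero => rfl
    | succ i => simp only [scons]; rw [h i (by omega)]; congr 1; omega

theorem guarded_apps {Sg : Sig} (Ns : List Tm) : ∀ {M}, Guarded Sg M →
    (∀ N ∈ Ns, Guarded Sg N) → Guarded Sg (apps M Ns) := by
  induction Ns with
  | nil => intro M h _; exact h
  | cons N Ns ih =>
    intro M h hN
    exact ih (Guarded.app h (hN N (by simp))) (fun N hN' => hN N (by simp [hN']))

theorem vlist_guarded {Sg : Sig} (n : ℕ) : ∀ N ∈ vlist n, Guarded Sg N := by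
  induction n with
  | zero => simp [vlist]
  | succ n ih =>
    intro N hN
    rcases List.mem_cons.1 hN with rfl | h
    · exact Guarded.var
    · exact ih N h

theorem GBase.conv_guarded {Sg : Sig} {Γ M τ} (h : GBase Sg Γ M τ) :
    ∀ n, Γ = List.replicate n .base → ∃ G, Guarded Sg G ∧ Conv M G := by
  induction h with
  | @var Γ i τ h1 h2 => intro n hn; exact ⟨_, Guarded.var, Relation.EqvGen.refl _⟩
  | @const Γ c τ h1 => intro n hn; exact ⟨_, Guarded.const, Relation.EqvGen.refl _⟩
  | @app Γ M N σ τ h1 h2 ih1 ih2 =>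
    intro n hn
    obtain ⟨G1, hG1, hc1⟩ := ih1 n hn
    obtain ⟨G2, hG2, hc2⟩ := ih2 n hn
    exact ⟨_, Guarded.app hG1 hG2, Conv.app hc1 hc2⟩
  | @fixI Γ f σf τ Ms h1 h2 h3 h4 ih =>
    rintro n rfl
    have hR := GBase.fixI h1 h2 h3 h4
    generalize hRdef : Tm.fix τ (lams τ.arity (apps (.const f) Ms)) = R at hR ⊢
    -- one unfolding of `R`
    have hMs : ∀ M ∈ Ms.map (Tm.msub (liftN τ.arity (scons R Tm.var))),
        GBase Sg (List.replicate τ.arity Ty.base ++ List.replicate n .base) M .base := by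
      intro M hM
      obtain ⟨M', hM', rfl⟩ := List.mem_map.1 hM
      exact (h4 M' hM').msub ((GSub.var.scons hR).liftN _ _)
    have hred : Red R (lams τ.arity (apps (.const f)
        (Ms.map (Tm.msub (liftN τ.arity (scons R Tm.var)))))) := by
      have := Red.fixUnfold (τ := τ) (M := lams τ.arity (apps (.const f) Ms))
      rw [subst_zero, hRdef, msub_lams, msub_apps] at this
      exact this
    have hlen : (Ms.map (Tm.msub (liftN τ.arity (scons R Tm.var)))).length = σf.arity := by
      simpa using h3
    generalize Ms.map (Tm.msub (liftN τ.arity (scons R Tm.var))) = Ms' at hMs hred hlen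
    -- the closed abstraction of the unfolding
    have hG : GBase Sg [] (.fix (arrows n τ) (lams (arrows n τ).arity (apps (.const f) Ms')))
        (arrows n τ) := by
      refine GBase.fixI h1 (arrows_order n h2) hlen ?_
      intro M hM
      have := (hMs M hM).ren (ξ := id)
        (Δ := List.replicate (arrows n τ).arity Ty.base ++ [arrows n τ]) ?_
      · rw [ren_eq_msub] at this
        have h5 := msub_var M
        exact (congrArg (fun X => GBase Sg _ X Ty.base) h5).mp this
      · intro i σ hi
        rw [← List.replicate_add] at hi
        rw [arrows_arity, add_comm n, id, List.getElem?_append_left]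
        · exact hi
        · exact (List.getElem?_eq_some_iff.1 hi).1
    refine ⟨apps _ (vlist n), guarded_apps _ (Guarded.base hG) (vlist_guarded n), ?_⟩
    refine Relation.EqvGen.trans _ _ _ (Relation.EqvGen.rel _ _ hred)
      (Relation.EqvGen.symm _ _ (RedStar.toConv ?_))
    refine Relation.ReflTransGen.head (Red.apps Red.fixUnfold _) ?_
    rw [subst_zero]
    generalize Tm.fix (arrows n τ) (lams (arrows n τ).arity (apps (.const f) Ms')) = G
    have hmb := multibeta (lams τ.arity (apps (.const f) Ms')) (vlist n) (scons G Tm.var)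
    rw [vlist_length, ← lams_add, ← arrows_arity, msub_lams τ.arity, msub_apps] at hmb
    have : Ms'.map (Tm.msub (liftN τ.arity (consN (vlist n) (scons G Tm.var)))) = Ms' := by
      conv_rhs => rw [← List.map_id Ms']
      refine List.map_congr_left fun M hM => ?_
      rw [id, (hMs M hM).agree (ρ' := Tm.var), msub_var]
      intro i hi
      rw [← liftN_var τ.arity]
      refine liftN_agree τ.arity (n := n) ?_ i (by simpa using hi)
      intro i hi
      exact consN_vlist n _ 0 (by simp) i (by simpa using hi)
    rw [this] at hmb
    exact hmb

/-! ### Normalization of guarded terms -/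

def SN (Sg : Sig) (n : ℕ) : Ty → Tm → Prop
  | .base, M => ∃ N, RedStar M N ∧ GBase Sg (List.replicate n .base) N .base
  | .arrow σ τ, M => ∀ N, SN Sg n σ N → SN Sg n τ (.app M N)

theorem SN.expand {Sg n} (τ : Ty) : ∀ {M M'}, RedStar M M' → SN Sg n τ M' → SN Sg n τ M := by
  induction τ with
  | base =>
    rintro M M' h ⟨N, h1, h2⟩
    exact ⟨N, Relation.ReflTransGen.trans h h1, h2⟩
  | arrow σ τ _ ih =>
    intro M M' h hM N hN
    exact ih (h.appL N) (hM N hN)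

theorem GBase.sn {Sg n} (hSg : Sg.FirstOrder) (τ : Ty) :
    ∀ {M}, GBase Sg (List.replicate n .base) M τ → SN Sg n τ M := by
  induction τ with
  | base => intro M h; exact ⟨M, Relation.ReflTransGen.refl, h⟩
  | arrow σ τ _ ih =>
    intro M h N hN
    have := h.arrow_base hSg
    subst this
    obtain ⟨N', h1, h2⟩ := hN
    exact SN.expand τ (RedStar.appR M h1) (ih (GBase.app h h2))

theorem GBase.ty_unique {Sg : Sig} {Γ M τ} (h : GBase Sg Γ M τ) :
    ∀ {Δ τ'}, HasTy Sg (Γ ++ Δ) M τ' → τ' = τ := by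
  induction h with
  | var h1 _ =>
    intro Δ τ' h
    cases h with
    | var h =>
      rw [List.getElem?_append_left (List.getElem?_eq_some_iff.1 h1).1, h1] at h
      simpa using h.symm
  | const h1 =>
    intro Δ τ' h
    cases h with
    | const h => rw [h1] at h; simpa using h.symm
  | app _ _ ih1 _ =>
    intro Δ τ' h
    cases h with
    | app h _ =>
      have := ih1 h
      injection this
  | fixI =>
    intro Δ τ' h
    cases h with
    | fixI h => rfl

theorem Guarded.fundamental {Sg : Sig} (hSg : Sg.FirstOrder) {n M} (h : Guarded Sg M) :
    ∀ {Γ τ} {ρ : ℕ → Tm}, HasTy Sg Γ M τ → (∀ i σ, Γ[i]? = some σ → SN Sg n σ (ρ i)) →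
    SN Sg n τ (Tm.msub ρ M) := by
  induction h with
  | base h =>
    intro Γ τ ρ ht hρ
    obtain rfl := h.ty_unique (Δ := Γ) ht
    refine GBase.sn hSg _ (h.msub ?_)
    intro i σ hi
    simp at hi
  | const =>
    intro Γ τ ρ ht hρ
    cases ht with
    | const h => exact GBase.sn hSg _ (GBase.const h)
  | var =>
    intro Γ τ ρ ht hρ
    cases ht with
    | var h => exact hρ _ _ h
  | app _ _ ih1 ih2 =>
    intro Γ τ ρ ht hρ
    cases ht with
    | app h1 h2 => exact ih1 h1 hρ _ (ih2 h2 hρ)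
  | lam _ ih =>
    intro Γ τ ρ ht hρ
    cases ht with
    | lam h1 =>
      intro N hN
      refine SN.expand _ (Relation.ReflTransGen.single Red.beta) ?_
      rw [subst_lift]
      refine ih h1 ?_
      intro i σ hi
      cases i with
      | zero => simp at hi; subst hi; exact hN
      | succ i => exact hρ i σ (by simpa using hi)

theorem Guarded.normalize {Sg : Sig} (hSg : Sg.FirstOrder) {n M} (h : Guarded Sg M)
    (ht : HasTy Sg (List.replicate n .base) M .base) :
    ∃ N, RedStar M N ∧ GBase Sg (List.replicate n .base) N .base := by
  have := h.fundamental hSg (n := n) (ρ := Tm.var) ht ?_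
  · rw [msub_var] at this
    exact this
  · intro i σ hi
    obtain ⟨_, rfl⟩ := replicate_getElem? hi
    exact GBase.sn hSg _ (GBase.var hi (by simp [Ty.order]))

/-! ### Semantics -/

theorem corec_inr {Sg : Sig} (θ : ℕ → GCoTerm Sg) (t : GCoTerm Sg) :
    PFunctor.M.corec (substStep θ) (Sum.inr t) = t := by
  refine PFunctor.M.bisim
    (fun x y => x = PFunctor.M.corec (substStep θ) (Sum.inr y)) ?_ _ _ rfl
  rintro x y rfl
  rw [PFunctor.M.dest_corec]
  simp only [substStep]
  rcases hd : PFunctor.M.dest y with ⟨a | e, k⟩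
  · exact ⟨Sum.inl a, _, k, rfl, rfl, fun i => rfl⟩
  · exact e.elim

theorem csubst_con {Sg : Sig} {t : CoTerm Sg ℕ} {f : String} {k}
    (h : PFunctor.M.dest t = ⟨Sum.inl f, k⟩) (θ : ℕ → GCoTerm Sg) :
    PFunctor.M.dest (csubst t θ) = ⟨Sum.inl f, fun i => csubst (k i) θ⟩ := by
  unfold csubst
  rw [PFunctor.M.dest_corec]
  simp only [substStep, h]
  rfl

theorem csubst_var {Sg : Sig} {t : CoTerm Sg ℕ} {v : ℕ} {k}
    (h : PFunctor.M.dest t = ⟨Sum.inr v, k⟩) (θ : ℕ → GCoTerm Sg) :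
    csubst t θ = θ v := by
  have h1 : PFunctor.M.dest (csubst t θ) =
      PFunctor.M.dest (PFunctor.M.corec (substStep θ) (Sum.inr (θ v))) := by
    unfold csubst
    rw [PFunctor.M.dest_corec, PFunctor.M.dest_corec]
    simp only [substStep, h]
  have h2 := congrArg PFunctor.M.mk h1
  exact ((PFunctor.M.mk_dest _).symm.trans h2).trans
    ((PFunctor.M.mk_dest _).trans (corec_inr θ (θ v)))

theorem sem_con {Sg : Sig} {sem : Tm → CoTerm Sg ℕ} (hsem : SemSpec Sg sem) {n M f}
    {Ns : List Tm} (h : Ns.length = Sg.ar f)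
    (hNs : ∀ N ∈ Ns, GBase Sg (List.replicate n .base) N .base)
    (hM : Conv M (apps (.const f) Ns)) :
    PFunctor.M.dest (sem M) =
      ⟨Sum.inl f, fun i => sem (Ns.get (Fin.cast h.symm i))⟩ := by
  have hex : ∃ Gs, List.Forall₂ Conv Ns Gs ∧ ∀ G ∈ Gs, Guarded Sg G := by
    clear h hM
    induction Ns with
    | nil => exact ⟨[], List.Forall₂.nil, by simp⟩
    | cons N Ns ih =>
      obtain ⟨Gs, h1, h2⟩ := ih (fun N hN => hNs N (by simp [hN]))
      obtain ⟨G, hG, hc⟩ := (hNs N (by simp)).conv_guarded n rfl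
      refine ⟨G :: Gs, List.Forall₂.cons hc h1, ?_⟩
      intro G' hG'
      rcases List.mem_cons.1 hG' with rfl | h'
      · exact hG
      · exact h2 _ h'
  obtain ⟨Gs, hc, hG⟩ := hex
  have hl : Gs.length = Sg.ar f := by rw [← hc.length_eq, h]
  rw [hsem.1 M (apps (.const f) Gs)
    (Relation.EqvGen.trans _ _ _ hM (Conv.apps hc (Relation.EqvGen.refl _)))]
  rw [hsem.2.1 _ f Gs hl hG Relation.ReflTransGen.refl]
  congr 1
  funext i
  refine (hsem.1 _ _ ?_).symm
  exact hc.get _ _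

theorem sem_msub_gbase {Sg : Sig} (hSg : Sg.FirstOrder) {sem : Tm → CoTerm Sg ℕ}
    (hsem : SemSpec Sg sem) {n l : ℕ} {ρ : ℕ → Tm}
    (hρ : ∀ j < n, GBase Sg (List.replicate l .base) (ρ j) .base) (θ : ℕ → GCoTerm Sg)
    {M : Tm} (hM : GBase Sg (List.replicate n .base) M .base) :
    csubst (sem (Tm.msub ρ M)) θ = csubst (sem M) (fun j => csubst (sem (ρ j)) θ) := by
  refine PFunctor.M.bisim (fun x y => x = y ∨
    ∃ M, GBase Sg (List.replicate n .base) M .base ∧ x = csubst (sem (Tm.msub ρ M)) θ ∧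
      y = csubst (sem M) (fun j => csubst (sem (ρ j)) θ)) ?_ _ _ (Or.inr ⟨M, hM, rfl, rfl⟩)
  clear hM M
  have hrefl : ∀ x y : GCoTerm Sg, x = y → ∃ a f f', PFunctor.M.dest x = ⟨a, f⟩ ∧
      PFunctor.M.dest y = ⟨a, f'⟩ ∧ ∀ i, (f i = f' i ∨
    ∃ M, GBase Sg (List.replicate n .base) M .base ∧ f i = csubst (sem (Tm.msub ρ M)) θ ∧
      f' i = csubst (sem M) (fun j => csubst (sem (ρ j)) θ)) := by
    rintro x y rfl
    exact ⟨_, _, _, rfl, rfl, fun i => Or.inl rfl⟩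
  rintro x y (h | ⟨M, hM, rfl, rfl⟩)
  · exact hrefl _ _ h
  · rcases hM.hnf hSg with ⟨j, hr⟩ | ⟨f, Ns, hl, hNs, hr⟩
    · refine hrefl _ _ ?_
      rw [csubst_var (hsem.2.2 M j hr), hsem.1 _ _ (hr.msub ρ).toConv]
      rfl
    · have hr' := hr.msub ρ
      rw [msub_apps] at hr'
      have h1 := sem_con hsem hl hNs hr.toConv
      have hl' : (Ns.map (Tm.msub ρ)).length = Sg.ar f := by simpa using hl
      have h2 := sem_con hsem (n := l) hl' (by
        intro N hN
        obtain ⟨N', hN', rfl⟩ := List.mem_map.1 hN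
        exact (hNs N' hN').msub (GSub.ofBase hρ)) hr'.toConv
      refine ⟨_, _, _, csubst_con h2 θ, csubst_con h1 _, ?_⟩
      intro i
      refine Or.inr ⟨Ns.get (Fin.cast hl.symm i), hNs _ (List.get_mem _ _), ?_, rfl⟩
      simp
      rfl

theorem sem_msub {Sg : Sig} (hSg : Sg.FirstOrder) {sem : Tm → CoTerm Sg ℕ}
    (hsem : SemSpec Sg sem) {n l : ℕ} {ρ : ℕ → Tm}
    (hρ : ∀ j < n, GBase Sg (List.replicate l .base) (ρ j) .base) (θ : ℕ → GCoTerm Sg)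
    {M : Tm} (hM : Guarded Sg M) (ht : HasTy Sg (List.replicate n .base) M .base) :
    csubst (sem (Tm.msub ρ M)) θ = csubst (sem M) (fun j => csubst (sem (ρ j)) θ) := by
  obtain ⟨N, hr, hN⟩ := hM.normalize hSg ht
  rw [hsem.1 _ _ hr.toConv, hsem.1 _ _ (hr.msub ρ).toConv]
  exact sem_msub_gbase hSg hsem hρ θ hN

theorem gsem_sub {Sg : Sig} {Pg : PSig} (hSg : Sg.FirstOrder) {sem : Tm → CoTerm Sg ℕ}
    (hsem : SemSpec Sg sem) {n l : ℕ} {ρ : ℕ → Tm}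
    (hρ : ∀ j < n, GBase Sg (List.replicate l .base) (ρ j) .base) (θ : ℕ → GCoTerm Sg)
    {A : Atm} (hA : A.WFg Sg Pg n) :
    (A.sub ρ).gsem sem θ = A.gsem sem (fun j => csubst (sem (ρ j)) θ) := by
  obtain ⟨τs, hp, hb, hF⟩ := hA
  simp only [Atm.gsem, Atm.sub, List.map_map]
  congr 1
  refine List.map_congr_left fun M hM => ?_
  have : ∃ τ ∈ τs, Guarded Sg M ∧ HasTy Sg (List.replicate n .base) M τ := by
    clear hb hp
    generalize A.args = as at hF hM
    induction hF with
    | nil => simp at hM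
    | cons h _ ih =>
      rcases List.mem_cons.1 hM with rfl | h'
      · exact ⟨_, by simp, h⟩
      · obtain ⟨τ, h1, h2⟩ := ih h'
        exact ⟨τ, by simp [h1], h2⟩
  obtain ⟨τ, hτ, hg, ht⟩ := this
  rw [hb τ hτ] at ht
  exact sem_msub hSg hsem hρ θ hg ht

theorem gsem_conv {Sg : Sig} {sem : Tm → CoTerm Sg ℕ} (hsem : SemSpec Sg sem)
    {A B : Atm} (h : AtmConv A B) (θ : ℕ → GCoTerm Sg) : A.gsem sem θ = B.gsem sem θ := by
  obtain ⟨p, as⟩ := A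
  obtain ⟨q, bs⟩ := B
  obtain ⟨h1, h2⟩ := h
  simp only at h1 h2
  subst h1
  simp only [Atm.gsem]
  congr 1
  induction h2 with
  | nil => rfl
  | cons h _ ih => simp [ih, hsem.1 _ _ h]

/-! ### Structure of annotated proofs -/

/-- How an atom of `D` is justified. -/
def Just (Sg : Sig) (P : Set HClause) (φC : HClause) (sem : Tm → CoTerm Sg ℕ)
    (D : Set Atm) (Ag : Set (ℕ → CoTerm Sg ℕ)) (A : Atm) : Prop :=
  (∃ C ∈ P, ∃ ρ : ℕ → Tm,
    (∀ j < C.n, GBase Sg (List.replicate φC.n Ty.base) (ρ j) Ty.base) ∧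
    AtmConv A (C.head.sub ρ) ∧ ∀ B ∈ C.body, B.sub ρ ∈ D) ∨
  (∃ B ∈ φC.body, AtmConv A B) ∨
  (∃ ρ : ℕ → Tm, (∀ j < φC.n, GBase Sg (List.replicate φC.n Ty.base) (ρ j) Ty.base) ∧
    AtmConv A (φC.head.sub ρ) ∧ (fun j => sem (ρ j)) ∈ Ag)

def AgJust (Sg : Sig) (φC : HClause) (sem : Tm → CoTerm Sg ℕ)
    (D : Set Atm) (g : ℕ → CoTerm Sg ℕ) : Prop :=
  ∃ ρ : ℕ → Tm, (∀ j < φC.n, GBase Sg (List.replicate φC.n Ty.base) (ρ j) Ty.base) ∧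
    g = (fun j => sem (ρ j)) ∧ ∀ B ∈ φC.body, B.sub ρ ∈ D

theorem Just.mono {Sg P φC sem D D' Ag Ag' A} (hD : D ⊆ D') (hAg : Ag ⊆ Ag')
    (h : Just Sg P φC sem D Ag A) : Just Sg P φC sem D' Ag' A := by
  rcases h with ⟨C, hC, ρ, h1, h2, h3⟩ | h | ⟨ρ, h1, h2, h3⟩
  · exact Or.inl ⟨C, hC, ρ, h1, h2, fun B hB => hD (h3 B hB)⟩
  · exact Or.inr (Or.inl h)
  · exact Or.inr (Or.inr ⟨ρ, h1, h2, hAg h3⟩)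

theorem AgJust.mono {Sg φC sem D D' g} (hD : D ⊆ D')
    (h : AgJust Sg φC sem D g) : AgJust Sg φC sem D' g := by
  obtain ⟨ρ, h1, h2, h3⟩ := h
  exact ⟨ρ, h1, h2, fun B hB => hD (h3 B hB)⟩

theorem AUniList.just {Sg P φC sem D Ag As} (h : AUniList Sg P φC sem D Ag As) :
    (∀ A ∈ As, A ∈ D) ∧ (∀ A ∈ D, Just Sg P φC sem D Ag A) ∧
      (∀ g ∈ Ag, AgJust Sg φC sem D g) := by
  refine AUniList.rec
    (motive_1 := fun D Ag A _ => A ∈ D ∧ (∀ A ∈ D, Just Sg P φC sem D Ag A) ∧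
      (∀ g ∈ Ag, AgJust Sg φC sem D g))
    (motive_2 := fun D Ag As _ => (∀ A ∈ As, A ∈ D) ∧ (∀ A ∈ D, Just Sg P φC sem D Ag A) ∧
      (∀ g ∈ Ag, AgJust Sg φC sem D g)) ?_ ?_ ?_ ?_ ?_ h
  · rintro D Ag A C ρ hC hρ hA _ ⟨h1, h2, h3⟩
    have hs : D ⊆ insert A D := Set.subset_insert _ _
    refine ⟨Set.mem_insert _ _, ?_, fun g hg => (h3 g hg).mono hs⟩
    rintro B (rfl | hB)
    · exact Or.inl ⟨C, hC, ρ, hρ, hA, fun B hB => hs (h1 _ (List.mem_map_of_mem hB))⟩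
    · exact (h2 B hB).mono hs subset_rfl
  · rintro A B hB hA
    refine ⟨rfl, ?_, by simp⟩
    rintro A' rfl
    exact Or.inr (Or.inl ⟨B, hB, hA⟩)
  · rintro D Ag A ρ hρ hA _ ⟨h1, h2, h3⟩
    have hs : D ⊆ insert A D := Set.subset_insert _ _
    refine ⟨Set.mem_insert _ _, ?_, ?_⟩
    · rintro B (rfl | hB)
      · exact Or.inr (Or.inr ⟨ρ, hρ, hA, Set.mem_insert _ _⟩)
      · exact (h2 B hB).mono hs (Set.subset_insert _ _)
    · rintro g (rfl | hg)
      · exact ⟨ρ, hρ, rfl, fun B hB => hs (h1 _ (List.mem_map_of_mem hB))⟩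
      · exact (h3 g hg).mono hs
  · simp
  · rintro D Ag D' Ag' A As _ _ ⟨h1, h2, h3⟩ ⟨h1', h2', h3'⟩
    refine ⟨?_, ?_, ?_⟩
    · intro B hB
      rcases List.mem_cons.1 hB with rfl | hB
      · exact Or.inl h1
      · exact Or.inr (h1' B hB)
    · rintro B (hB | hB)
      · exact (h2 B hB).mono Set.subset_union_left Set.subset_union_left
      · exact (h2' B hB).mono Set.subset_union_right Set.subset_union_right
    · rintro g (hg | hg)
      · exact (h3 g hg).mono Set.subset_union_left
      · exact (h3' g hg).mono Set.subset_union_right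

end Helpers

/-- **Extraction of a coinduction invariant from a CUP proof**: let `φC` be an
`H^g`-formula `∀x⃗. A₁ ∧ … ∧ A_q → A₀` with a CUP proof `π` of `Σ; P ⊢co φC`,
let `D` be the set of atoms proven in `π` and `θ₁, …, θ_m` (here `ag`) the
agents of `π`, and fix a ground substitution `θ₀` for the eigenvariables.  If
`I₁` is an invariant for `{ ⟦A_k[c⃗/x⃗]⟧[Θ(ε)] | 1 ≤ k ≤ q }`, then
`I = I₁ ∪ ⋃_w ⟦D⟧[Θ(w)]` is an invariant for `⟦A₀[c⃗/x⃗]⟧[Θ(ε)]`. -/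
theorem cup_invariant_construction (Sg : Sig) (Pg : PSig) (hSg : Sg.FirstOrder)
    (sem : Tm → CoTerm Sg ℕ) (hsem : SemSpec Sg sem)
    (P : Set HClause) (hP : ∀ C ∈ P, C.WFg Sg Pg)
    (φC : HClause) (hφC : φC.WFg Sg Pg)
    (D : Set Atm) (Ag : Set (ℕ → CoTerm Sg ℕ))
    (hπ : AGua Sg P φC sem D Ag)
    (m : ℕ) (ag : Fin m → (ℕ → CoTerm Sg ℕ)) (hag : Ag = Set.range ag)
    (θ₀ : ℕ → GCoTerm Sg)
    (I₁ : Set (HBase Sg))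
    (hI₁ : IsInv P sem {a | ∃ B ∈ φC.body, a = B.gsem sem (Theta θ₀ ag [])} I₁) :
    IsInv P sem {φC.head.gsem sem (Theta θ₀ ag [])}
      (I₁ ∪ ⋃ w : List (Fin m), (fun A => A.gsem sem (Theta θ₀ ag w)) '' D) := by
  obtain ⟨C₀, hC₀, ρ₀, hρ₀, hA₀, D', Ag', hL, rfl, rfl⟩ := hπ
  obtain ⟨j1, j2, j3⟩ := hL.just
  subst hag
  set I := I₁ ∪ ⋃ w : List (Fin m),
    (fun A => A.gsem sem (Theta θ₀ ag w)) '' (insert φC.head D') with hI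
  have hmem : ∀ A ∈ insert φC.head D', ∀ w, A.gsem sem (Theta θ₀ ag w) ∈ I := by
    intro A hA w
    exact Or.inr (Set.mem_iUnion.2 ⟨w, A, hA, rfl⟩)
  -- the clause case
  have hclause : ∀ (A : Atm) (C : HClause), C ∈ P → ∀ ρ : ℕ → Tm,
      (∀ j < C.n, GBase Sg (List.replicate φC.n Ty.base) (ρ j) Ty.base) →
      AtmConv A (C.head.sub ρ) → (∀ B ∈ C.body, B.sub ρ ∈ D') →
      ∀ w, A.gsem sem (Theta θ₀ ag w) ∈ PhiP P sem I := by
    intro A C hC ρ hρ hA hB w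
    refine ⟨C, hC, fun j => csubst (sem (ρ j)) (Theta θ₀ ag w), ?_, ?_⟩
    · rw [gsem_conv hsem hA, gsem_sub hSg hsem hρ _ (hP C hC).1]
    · intro B hBm
      rw [← gsem_sub hSg hsem hρ _ ((hP C hC).2 B hBm)]
      exact hmem _ (Or.inr (hB B hBm)) w
  have hhead : ∀ w, φC.head.gsem sem (Theta θ₀ ag w) ∈ PhiP P sem I :=
    hclause _ C₀ hC₀ ρ₀ hρ₀ hA₀ (fun B hB => j1 _ (List.mem_map_of_mem hB))
  have hD : ∀ w, ∀ A ∈ D', A.gsem sem (Theta θ₀ ag w) ∈ PhiP P sem I := by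
    intro w
    induction w with
    | nil =>
      intro A hA
      rcases j2 A hA with ⟨C, hC, ρ, h1, h2, h3⟩ | ⟨B, hB, hc⟩ | ⟨ρ, h1, h2, k, hk⟩
      · exact hclause A C hC ρ h1 h2 h3 _
      · rw [gsem_conv hsem hc]
        exact PhiP_mono P sem Set.subset_union_left (hI₁.2 (hI₁.1 ⟨B, hB, rfl⟩))
      · rw [gsem_conv hsem h2, gsem_sub hSg hsem h1 _ hφC.1]
        have := hhead [k]
        simp only [Theta, hk] at this
        exact this
    | cons k' w ih =>
      intro A hA
      rcases j2 A hA with ⟨C, hC, ρ, h1, h2, h3⟩ | ⟨B, hB, hc⟩ | ⟨ρ, h1, h2, k, hk⟩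
      · exact hclause A C hC ρ h1 h2 h3 _
      · rw [gsem_conv hsem hc]
        obtain ⟨ρ, h1, h2, h3⟩ := j3 (ag k') ⟨k', rfl⟩
        have := ih _ (h3 B hB)
        rw [gsem_sub hSg hsem h1 _ (hφC.2 B hB)] at this
        simp only [Theta, h2]
        exact this
      · rw [gsem_conv hsem h2, gsem_sub hSg hsem h1 _ hφC.1]
        have := hhead (k :: k' :: w)
        rw [Theta] at this
        simp only [hk] at this
        exact this
  refine ⟨?_, ?_⟩
  · rintro a rfl
    exact hmem _ (Or.inl rfl) []
  · rintro a (ha | ha)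
    · exact PhiP_mono P sem Set.subset_union_left (hI₁.2 ha)
    · obtain ⟨w, A, (rfl | hA), rfl⟩ := Set.mem_iUnion.1 ha
      · exact hhead w
      · exact hD w A hA
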